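/- For every integer k ≥ 0, there exists a bipartite graph G that admits a 2-layer k-planar drawing and whose pathwidth is exactly k + 1. -/

import Mathlib

/-- A path decomposition of a graph `G` with bags `B 0, …, B (n-1)` arranged along a path:
every vertex is in some bag, every edge has both endpoints in a common bag, and the bags
containing any fixed vertex form a contiguous interval. -/
def IsPathDecomp {V : Type*} (G : SimpleGraph V) (n : ℕ) (B : Fin n → Finset V) : Prop :=
  (∀ v : V, ∃ i, v ∈ B i) ∧
  (∀ u v : V, G.Adj u v → ∃ i, u ∈ B i ∧ v ∈ B i) ∧
  (∀ (v : V) (i j l : Fin n), i ≤ j → j ≤ l → v ∈ B i → v ∈ B l → v ∈ B j)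

/-- The pathwidth of `G`: the least `w` such that `G` has a path decomposition
all of whose bags have at most `w + 1` vertices. -/
noncomputable def pathwidth {V : Type*} (G : SimpleGraph V) : ℕ :=
  sInf {w | ∃ (n : ℕ) (B : Fin n → Finset V), IsPathDecomp G n B ∧ ∀ i, (B i).card ≤ w + 1}

/-- A 2-layer drawing of a bipartite graph `G` with bipartition `(X, Y)`:
the vertices of `X` (resp. `Y`) are placed at positions `1, …, |X|` (resp. `1, …, |Y|`)
on two parallel lines, i.e. `pos` restricts to bijections `X → {1, …, |X|}` and
`Y → {1, …, |Y|}`. -/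
structure TwoLayerDrawing {V : Type*} (G : SimpleGraph V) (X Y : Finset V) where
  pos : V → ℕ
  cover : ∀ v : V, v ∈ X ∨ v ∈ Y
  disj : ∀ v : V, ¬(v ∈ X ∧ v ∈ Y)
  bipart : ∀ u v : V, G.Adj u v → ((u ∈ X ∧ v ∈ Y) ∨ (u ∈ Y ∧ v ∈ X))
  bijX : Set.BijOn pos ↑X (Set.Icc 1 X.card)
  bijY : Set.BijOn pos ↑Y (Set.Icc 1 Y.card)

/-- Two edges `{x₁, y₁}` and `{x₂, y₂}` with `x₁, x₂ ∈ X`, `y₁, y₂ ∈ Y` cross in the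
drawing iff one has its `X`-endpoint to the left of the other's but its `Y`-endpoint
to the right. -/
def TwoLayerDrawing.Crosses {V : Type*} {G : SimpleGraph V} {X Y : Finset V}
    (D : TwoLayerDrawing G X Y) (e₁ e₂ : Sym2 V) : Prop :=
  ∃ x₁ y₁ x₂ y₂ : V, x₁ ∈ X ∧ x₂ ∈ X ∧ y₁ ∈ Y ∧ y₂ ∈ Y ∧
    e₁ = s(x₁, y₁) ∧ e₂ = s(x₂, y₂) ∧
    ((D.pos x₁ < D.pos x₂ ∧ D.pos y₂ < D.pos y₁) ∨
      (D.pos x₂ < D.pos x₁ ∧ D.pos y₁ < D.pos y₂))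

/-- A 2-layer drawing is `k`-planar if every edge crosses at most `k` other edges. -/
def TwoLayerDrawing.IsKPlanar {V : Type*} {G : SimpleGraph V} {X Y : Finset V}
    (D : TwoLayerDrawing G X Y) (k : ℕ) : Prop :=
  ∀ e ∈ G.edgeSet, {e' | e' ∈ G.edgeSet ∧ D.Crosses e e'}.ncard ≤ k

/-- `G` is a 2-layer `k`-planar graph if it admits a 2-layer `k`-planar drawing with
respect to some bipartition. -/
def IsTwoLayerKPlanar {V : Type*} (G : SimpleGraph V) (k : ℕ) : Prop :=
  ∃ (X Y : Finset V) (D : TwoLayerDrawing G X Y), D.IsKPlanar k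

open Finset

section General

variable {V : Type}

theorem pw_set_nonempty [Fintype V] (G : SimpleGraph V) :
    {w | ∃ (n : ℕ) (B : Fin n → Finset V), IsPathDecomp G n B ∧
      ∀ i, (B i).card ≤ w + 1}.Nonempty := by
  refine ⟨Fintype.card V, 1, fun _ => Finset.univ, ⟨?_, ?_, ?_⟩, ?_⟩
  · intro v; exact ⟨0, Finset.mem_univ _⟩
  · intro u v _; exact ⟨0, Finset.mem_univ _, Finset.mem_univ _⟩
  · intros; exact Finset.mem_univ _
  · intro i; simp

theorem pw_spec [Fintype V] (G : SimpleGraph V) :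
    ∃ (n : ℕ) (B : Fin n → Finset V), IsPathDecomp G n B ∧
      ∀ i, (B i).card ≤ pathwidth G + 1 :=
  Nat.sInf_mem (pw_set_nonempty G)

theorem pw_le (G : SimpleGraph V) (w n : ℕ) (B : Fin n → Finset V)
    (h : IsPathDecomp G n B) (hc : ∀ i, (B i).card ≤ w + 1) : pathwidth G ≤ w :=
  Nat.sInf_le ⟨n, B, h, hc⟩

theorem pw_bot [Fintype V] : pathwidth (⊥ : SimpleGraph V) = 0 := by
  have e := (Fintype.equivFin V).symm
  apply Nat.le_zero.1
  refine pw_le _ 0 (Fintype.card V) (fun i => {e i}) ⟨?_, ?_, ?_⟩ ?_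
  · intro v; exact ⟨e.symm v, by simp⟩
  · intro u v h; exact absurd h (by simp)
  · intro v i j l hij hjl hi hl
    simp only [Finset.mem_singleton] at hi hl ⊢
    have : i = l := e.injective (hi.symm.trans hl)
    subst this
    have : i = j := le_antisymm hij hjl
    subst this
    exact hi
  · intro i; simp

theorem pw_delete [Fintype V] (G : SimpleGraph V) (u v : V) :
    pathwidth G ≤ pathwidth (G.deleteEdges {s(u, v)}) + 1 := by
  classical
  obtain ⟨n, B, ⟨h1, h2, h3⟩, hc⟩ := pw_spec (G.deleteEdges {s(u, v)})
  refine pw_le _ _ n (fun i => insert u (B i)) ⟨?_, ?_, ?_⟩ ?_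
  · intro w; obtain ⟨i, hi⟩ := h1 w; exact ⟨i, Finset.mem_insert_of_mem hi⟩
  · intro a b hab
    by_cases hs : s(a, b) = s(u, v)
    · obtain ⟨i, hi⟩ := h1 v
      rw [Sym2.eq_iff] at hs
      rcases hs with ⟨rfl, rfl⟩ | ⟨rfl, rfl⟩
      · exact ⟨i, Finset.mem_insert_self _ _, Finset.mem_insert_of_mem hi⟩
      · exact ⟨i, Finset.mem_insert_of_mem hi, Finset.mem_insert_self _ _⟩
    · obtain ⟨i, hi, hj⟩ := h2 a b (by
        rw [SimpleGraph.deleteEdges_adj]; exact ⟨hab, by simpa using hs⟩)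
      exact ⟨i, Finset.mem_insert_of_mem hi, Finset.mem_insert_of_mem hj⟩
  · intro w i j l hij hjl hi hl
    by_cases hw : w = u
    · subst hw; exact Finset.mem_insert_self _ _
    · simp only [Finset.mem_insert, hw, false_or] at hi hl ⊢
      exact h3 w i j l hij hjl hi hl
  · intro i
    exact (Finset.card_insert_le _ _).trans (Nat.succ_le_succ (hc i))

theorem planar_mono [Fintype V] {G H : SimpleGraph V} (hle : H ≤ G) {k : ℕ}
    (h : IsTwoLayerKPlanar G k) : IsTwoLayerKPlanar H k := by
  obtain ⟨X, Y, D, hD⟩ := h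
  refine ⟨X, Y, ⟨D.pos, D.cover, D.disj, fun u v huv => D.bipart u v (hle huv),
    D.bijX, D.bijY⟩, ?_⟩
  intro e he
  refine le_trans (Set.ncard_le_ncard ?_ (Set.toFinite _))
    (hD e (SimpleGraph.edgeSet_mono hle he))
  rintro e' ⟨he', hcr⟩
  exact ⟨SimpleGraph.edgeSet_mono hle he', hcr⟩

theorem exists_exact [Fintype V] (G : SimpleGraph V) (k : ℕ) (h : IsTwoLayerKPlanar G k)
    (hp : k + 1 ≤ pathwidth G) :
    ∃ H : SimpleGraph V, IsTwoLayerKPlanar H k ∧ pathwidth H = k + 1 := by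
  classical
  obtain ⟨H, hHG, hmin⟩ :=
    exists_minimal_le_of_wellFoundedLT (fun H : SimpleGraph V => k + 1 ≤ pathwidth H) G hp
  refine ⟨H, planar_mono hHG h, le_antisymm ?_ hmin.prop⟩
  by_cases hb : H = ⊥
  · rw [hb, pw_bot]; omega
  · obtain ⟨u, v, huv⟩ := SimpleGraph.ne_bot_iff_exists_adj.1 hb
    refine (pw_delete H u v).trans ?_
    by_contra hcon
    have h1 : k + 1 ≤ pathwidth (H.deleteEdges {s(u, v)}) := by omega
    have h2 := hmin.le_of_le h1 (SimpleGraph.deleteEdges_le _)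
    have := h2 huv
    rw [SimpleGraph.deleteEdges_adj] at this
    simp at this

end General

/-- The combinatorial contradiction about the positions of the legs. -/
theorem order_contra (k N : ℕ) (hN : 2 * k < N) (f : ℕ → ℕ)
    (h : ∀ t < N, ∃ S : Finset ℕ, S.card ≤ k ∧
      ((∀ s < N, s ∉ S → f s < f t) ∨ (∀ s < N, s ∉ S → f t < f s))) : False := by
  classical
  set L := (range N).filter (fun t => ∃ S : Finset ℕ, S.card ≤ k ∧
      (∀ s < N, s ∉ S → f s < f t)) with hL
  set R := (range N).filter (fun t => ∃ S : Finset ℕ, S.card ≤ k ∧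
      (∀ s < N, s ∉ S → f t < f s)) with hR
  have hun : ∀ t < N, t ∈ L ∨ t ∈ R := by
    intro t ht
    obtain ⟨S, hS, h1 | h1⟩ := h t ht
    · left; simp only [hL, mem_filter, mem_range]; exact ⟨ht, S, hS, h1⟩
    · right; simp only [hR, mem_filter, mem_range]; exact ⟨ht, S, hS, h1⟩
  have hbig : ∀ S : Finset ℕ, S.card ≤ k → N - k ≤ (range N \ S).card := by
    intro S hS
    have := Finset.le_card_sdiff S (range N)
    simp only [card_range] at this
    omega
  -- an element cannot be both
  have hdis : Disjoint L R := by
    rw [Finset.disjoint_left]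
    intro t htL htR
    simp only [hL, hR, mem_filter, mem_range] at htL htR
    obtain ⟨_, S, hS, h1⟩ := htL
    obtain ⟨_, S', hS', h2⟩ := htR
    have : (S ∪ S').card < (range N).card := by
      have := Finset.card_union_le S S'
      simp only [card_range]; omega
    obtain ⟨s, hs, hs'⟩ := Finset.exists_mem_notMem_of_card_lt_card this
    simp only [mem_union, not_or, mem_range] at hs hs'
    have a := h1 s hs hs'.1
    have b := h2 s hs hs'.2
    omega
  have hLN : L ⊆ range N := filter_subset _ _
  have hRN : R ⊆ range N := filter_subset _ _
  have cR : N - k ≤ R.card := by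
    rcases L.eq_empty_or_nonempty with he | hne
    · have : range N ⊆ R := by
        intro t ht
        rcases hun t (mem_range.1 ht) with h' | h'
        · rw [he] at h'; simp at h'
        · exact h'
      have := card_le_card this
      simp only [card_range] at this; omega
    · obtain ⟨t, ht, hmin⟩ := L.exists_min_image f hne
      have ht' := ht
      simp only [hL, mem_filter, mem_range] at ht'
      obtain ⟨_, S, hS, h1⟩ := ht'
      refine (hbig S hS).trans (card_le_card ?_)
      intro s hs
      simp only [mem_sdiff, mem_range] at hs
      rcases hun s hs.1 with h' | h'
      · have := hmin s h'
        have := h1 s hs.1 hs.2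
        omega
      · exact h'
  have cL : N - k ≤ L.card := by
    rcases R.eq_empty_or_nonempty with he | hne
    · have : range N ⊆ L := by
        intro t ht
        rcases hun t (mem_range.1 ht) with h' | h'
        · exact h'
        · rw [he] at h'; simp at h'
      have := card_le_card this
      simp only [card_range] at this; omega
    · obtain ⟨t, ht, hmin⟩ := R.exists_max_image f hne
      have ht' := ht
      simp only [hR, mem_filter, mem_range] at ht'
      obtain ⟨_, S, hS, h1⟩ := ht'
      refine (hbig S hS).trans (card_le_card ?_)
      intro s hs
      simp only [mem_sdiff, mem_range] at hs
      rcases hun s hs.1 with h' | h'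
      · exact h'
      · have := hmin s h'
        have := h1 s hs.1 hs.2
        omega
  have := card_le_card (union_subset hLN hRN)
  rw [card_union_of_disjoint hdis, card_range] at this
  omega

/-- The edge relation between top index `i` and bottom index `j`. -/
def StripE (M i j : ℕ) : Prop :=
  (j = i ∧ ¬ M ∣ i) ∨ (j = i + M ∧ (¬ M ∣ i ∨ (M + 1) ∣ i)) ∨ (j = i + 1 ∧ (M + 1) ∣ i)

/-- The strip graph on `n` top and `n` bottom vertices. -/
def strip (M n : ℕ) : SimpleGraph (Fin n ⊕ Fin n) where
  Adj u v := (∃ i j : Fin n, u = Sum.inl i ∧ v = Sum.inr j ∧ StripE M i j) ∨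
    (∃ i j : Fin n, v = Sum.inl i ∧ u = Sum.inr j ∧ StripE M i j)
  symm := ⟨fun u v h => Or.symm h⟩
  loopless := ⟨fun u h => by
    rcases h with ⟨i, j, h1, h2, _⟩ | ⟨i, j, h1, h2, _⟩ <;> rw [h1] at h2 <;> cases h2⟩

theorem strip_adj {M n : ℕ} {i j : Fin n} (h : StripE M i j) :
    (strip M n).Adj (Sum.inl i) (Sum.inr j) := Or.inl ⟨i, j, rfl, rfl, h⟩

def stripDrawing (M n : ℕ) : TwoLayerDrawing (strip M n)
    (Finset.univ.map Function.Embedding.inl) (Finset.univ.map Function.Embedding.inr) where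
  pos := fun v => Sum.elim (fun i : Fin n => (i : ℕ) + 1) (fun i : Fin n => (i : ℕ) + 1) v
  cover := by rintro (i | i) <;> simp
  disj := by rintro (i | i) <;> simp
  bipart := by
    rintro u v (⟨i, j, rfl, rfl, _⟩ | ⟨i, j, rfl, rfl, _⟩)
    · left; simp
    · right; simp
  bijX := by
    refine ⟨?_, ?_, ?_⟩
    · rintro v hv
      simp only [Finset.coe_map, Set.mem_image] at hv
      obtain ⟨i, _, rfl⟩ := hv
      simp
    · rintro u hu v hv huv
      simp only [Finset.coe_map, Set.mem_image] at hu hv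
      obtain ⟨i, _, rfl⟩ := hu
      obtain ⟨j, _, rfl⟩ := hv
      simp at huv
      have : i = j := Fin.ext huv
      rw [this]
    · rintro p hp
      simp at hp
      refine ⟨Sum.inl ⟨p - 1, by omega⟩, by simp, ?_⟩
      simp; omega
  bijY := by
    refine ⟨?_, ?_, ?_⟩
    · rintro v hv
      simp only [Finset.coe_map, Set.mem_image] at hv
      obtain ⟨i, _, rfl⟩ := hv
      simp
    · rintro u hu v hv huv
      simp only [Finset.coe_map, Set.mem_image] at hu hv
      obtain ⟨i, _, rfl⟩ := hu
      obtain ⟨j, _, rfl⟩ := hv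
      simp at huv
      have : i = j := Fin.ext huv
      rw [this]
    · rintro p hp
      simp at hp
      refine ⟨Sum.inr ⟨p - 1, by omega⟩, by simp, ?_⟩
      simp; omega

theorem strip_edge {M n : ℕ} {x y : Fin n}
    (h : s((Sum.inl x : Fin n ⊕ Fin n), Sum.inr y) ∈ (strip M n).edgeSet) : StripE M x y := by
  rw [SimpleGraph.mem_edgeSet] at h
  rcases h with ⟨i, j, h1, h2, h⟩ | ⟨i, j, h1, h2, h⟩
  · cases h1; cases h2; exact h
  · cases h1

/-- Number of crossings, in index form: crossing pairs lie in the image of a small set. -/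
theorem cross_cover (M i j : ℕ) (hM : 0 < M) (h : StripE M i j) :
    ∃ (S : Finset ℕ) (g : ℕ → ℕ × ℕ), S.card ≤ M - 1 ∧
      ∀ p q, StripE M p q → ((i < p ∧ q < j) ∨ (p < i ∧ j < q)) → (p, q) ∈ S.image g := by
  have down : ∀ j, (j = i ∨ j = i + 1) → ∃ (S : Finset ℕ) (g : ℕ → ℕ × ℕ), S.card ≤ M - 1 ∧
      ∀ p q, StripE M p q → ((i < p ∧ q < j) ∨ (p < i ∧ j < q)) → (p, q) ∈ S.image g := by
    intro j hj
    refine ⟨Finset.Ico (i + 1 - M) i, fun l => (l, l + M), by simp; omega, ?_⟩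
    intro p q hpq hc
    simp only [mem_image, mem_Ico, Prod.mk.injEq]
    rcases hpq with ⟨h1, h2⟩ | ⟨h1, h2⟩ | ⟨h1, h2⟩
    · omega
    · exact ⟨p, by omega, rfl, h1.symm⟩
    · omega
  rcases h with ⟨h1, h2⟩ | ⟨h1, h2⟩ | ⟨h1, h2⟩
  · exact down j (Or.inl h1)
  · subst h1
    refine ⟨Finset.Ioo i (i + M), fun l => if M ∣ l then
      ((M + 1) * (i / (M + 1) + 1), (M + 1) * (i / (M + 1) + 1) + 1) else (l, l), by simp, ?_⟩
    intro p q hpq hc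
    simp only [mem_image, mem_Ioo]
    rcases hpq with ⟨h3, h4⟩ | ⟨h3, h4⟩ | ⟨h3, h4⟩
    · subst h3
      refine ⟨q, by omega, ?_⟩
      rw [if_neg h4]
    · omega
    · subst h3
      have hp : p = (M + 1) * (i / (M + 1) + 1) := by
        obtain ⟨c, rfl⟩ := h4
        congr 1
        have e1 := Nat.div_add_mod i (M + 1)
        have e2 : i % (M + 1) < M + 1 := Nat.mod_lt i (Nat.succ_pos M)
        generalize i % (M + 1) = m at *
        generalize i / (M + 1) = d at *
        have a1 : d < c := by
          by_contra hcon
          have := Nat.mul_le_mul_left (M + 1) (not_lt.1 hcon)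
          omega
        have a2 : c < d + 2 := by
          by_contra hcon
          have := Nat.mul_le_mul_left (M + 1) (not_lt.1 hcon)
          rw [Nat.mul_add] at this
          omega
        omega
      by_cases hMi : M ∣ i
      · exfalso
        have h5 : (M + 1) ∣ i := by tauto
        have h6 : (M + 1) ∣ p - i := Nat.dvd_sub h4 h5
        have := Nat.le_of_dvd (by omega) h6
        omega
      · refine ⟨M * (i / M + 1), ?_, ?_⟩
        · have e1 := Nat.div_add_mod i M
          have e2 := Nat.mod_lt i hM
          have e3 : i % M ≠ 0 := fun h => hMi (Nat.dvd_of_mod_eq_zero h)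
          rw [Nat.mul_add]
          omega
        · rw [if_pos (Nat.dvd_mul_right _ _), ← hp]
  · exact down j (Or.inr h1)

theorem strip_planar (k n : ℕ) : IsTwoLayerKPlanar (strip (k + 1) n) k := by
  classical
  refine ⟨_, _, stripDrawing (k + 1) n, ?_⟩
  intro e he
  -- write e as inl i, inr j
  obtain ⟨i, j, rfl, hE⟩ : ∃ i j : Fin n, e = s(Sum.inl i, Sum.inr j) ∧
      StripE (k + 1) i j := by
    induction e using Sym2.ind with
    | _ u v =>
      rcases he with ⟨i, j, rfl, rfl, h⟩ | ⟨i, j, rfl, rfl, h⟩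
      · exact ⟨i, j, rfl, h⟩
      · exact ⟨i, j, Sym2.eq_swap, h⟩
  obtain ⟨S, g, hS, hcov⟩ := cross_cover (k + 1) i j (by omega) hE
  let F : Fin n × Fin n → Sym2 (Fin n ⊕ Fin n) := fun p => s(Sum.inl p.1, Sum.inr p.2)
  let T : Finset (Fin n × Fin n) :=
    Finset.univ.filter (fun p => ((p.1 : ℕ), (p.2 : ℕ)) ∈ S.image g)
  have hT : T.card ≤ k := by
    have h1 : T.card ≤ (S.image g).card := by
      apply Finset.card_le_card_of_injOn (fun p => ((p.1 : ℕ), (p.2 : ℕ)))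
      · intro p hp
        simpa [T] using hp
      · rintro ⟨a, b⟩ _ ⟨c, d⟩ _ h
        simp only [Prod.mk.injEq] at h
        exact Prod.ext (Fin.ext h.1) (Fin.ext h.2)
    have := Finset.card_image_le (s := S) (f := g)
    omega
  refine le_trans (Set.ncard_le_ncard (t := ((T.image F : Finset _) : Set _)) ?_
    (Finset.finite_toSet _)) ?_
  · rintro e' ⟨he', x₁, y₁, x₂, y₂, hx₁, hx₂, hy₁, hy₂, h1, rfl, hc⟩
    simp only [Finset.mem_map, Finset.mem_univ, true_and] at hx₁ hx₂ hy₁ hy₂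
    obtain ⟨a, rfl⟩ := hx₁
    obtain ⟨p, rfl⟩ := hx₂
    obtain ⟨b, rfl⟩ := hy₁
    obtain ⟨q, rfl⟩ := hy₂
    have hab : i = a ∧ j = b := by
      simpa using h1
    obtain ⟨rfl, rfl⟩ := hab
    have hpq : StripE (k + 1) p q := strip_edge he'
    simp only [Finset.coe_image, Set.mem_image]
    refine ⟨(p, q), ?_, rfl⟩
    have := hcov p q hpq (by
      simp [stripDrawing] at hc
      exact hc)
    simpa [T] using this
  · rw [Set.ncard_coe_finset]
    exact Finset.card_image_le.trans hT

theorem side_imp {V : Type} {G : SimpleGraph V} {n : ℕ} {B : Fin n → Finset V}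
    (hB : IsPathDecomp G n B) (I : Fin n) {u v : V} (huv : G.Adj u v)
    (hu : u ∉ B I) (hv : v ∉ B I) (h : ∃ l, l < I ∧ u ∈ B l) : ∃ l, l < I ∧ v ∈ B l := by
  obtain ⟨l, hl, hul⟩ := h
  obtain ⟨m, hum, hvm⟩ := hB.2.1 u v huv
  rcases lt_trichotomy m I with h | h | h
  · exact ⟨m, h, hvm⟩
  · subst h; exact absurd hum hu
  · exact absurd (hB.2.2 u l I m hl.le h.le hul hum) hu

theorem row_const (M n r : ℕ) (hr : 0 < r) (hrM : r < M) (PX PY : ℕ → Prop)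
    (h : ∀ i j, i < n → j < n → i % M = r → j % M = r → StripE M i j → (PX i ↔ PY j)) :
    ∀ q, r + q * M < n → (PX (r + q * M) ↔ PX r) := by
  have hmod : ∀ q, (r + q * M) % M = r := by
    intro q; rw [Nat.add_mul_mod_self_right, Nat.mod_eq_of_lt hrM]
  have hnd : ∀ q, ¬ M ∣ (r + q * M) := by
    intro q hd
    have := Nat.mod_eq_zero_of_dvd hd
    rw [hmod] at this; omega
  intro q
  induction q with
  | zero => intro _; simp
  | succ q ih =>
    intro hq
    have e : r + (q + 1) * M = r + q * M + M := by ring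
    have hq' : r + q * M < n := by omega
    rw [← ih hq', h (r + q * M) (r + (q + 1) * M) hq' hq (hmod _) (hmod _)
      (Or.inr (Or.inl ⟨e, Or.inl (hnd _)⟩))]
    exact h _ _ hq hq (hmod _) (hmod _) (Or.inl ⟨rfl, hnd _⟩)

theorem col_const (M a n : ℕ) (hn : a + M * (M + 1) ≤ n) (ha : M * (M + 1) ∣ a)
    (PX PY : ℕ → Prop)
    (h : ∀ i j, i < n → j < n → a ≤ i → i < a + M * (M + 1) → a ≤ j → j < a + M * (M + 1) →
      StripE M i j → (PX i ↔ PY j)) :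
    ∀ r, r + 1 < M → (PX (a + (r + 1)) ↔ PX a) := by
  have haM : M ∣ a := (Dvd.intro _ rfl).trans ha
  have haM1 : (M + 1) ∣ a := (Dvd.intro_left _ rfl).trans ha
  have hnd : ∀ r q, 0 < r → r < M → ¬ M ∣ (a + r + q * M) := by
    intro r q h0 h1 hd
    rw [Nat.dvd_add_left (Nat.dvd_mul_left _ _), Nat.dvd_add_right haM] at hd
    exact absurd (Nat.le_of_dvd h0 hd) (by omega)
  have hlt : ∀ r q, r < M → q ≤ M → a + r + q * M < a + M * (M + 1) := by
    intro r q h0 h1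
    have : q * M ≤ M * M := Nat.mul_le_mul_right _ h1
    rw [Nat.mul_add]; omega
  have xy : ∀ r q, 0 < r → r < M → q ≤ M →
      (PX (a + r + q * M) ↔ PY (a + r + q * M)) := by
    intro r q h0 h1 h2
    have := hlt r q h1 h2
    exact h _ _ (by omega) (by omega) (by omega) this (by omega) this
      (Or.inl ⟨rfl, hnd r q h0 h1⟩)
  have row : ∀ r, 0 < r → r < M → ∀ q, q ≤ M → (PX (a + r + q * M) ↔ PX (a + r)) := by
    intro r h0 h1 q
    induction q with
    | zero => intro _; simp
    | succ q ih =>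
      intro hq
      have e : a + r + (q + 1) * M = a + r + q * M + M := by ring
      have l1 := hlt r q h1 (by omega)
      have l2 := hlt r (q + 1) h1 hq
      rw [← ih (by omega), xy r (q + 1) h0 h1 hq]
      exact (h _ _ (by omega) (by omega) (by omega) l1 (by omega) l2
        (Or.inr (Or.inl ⟨e, Or.inl (hnd r q h0 h1)⟩))).symm
  intro r
  induction r with
  | zero =>
    intro h1
    have l0 := hlt 0 0 (by omega) (by omega)
    have l1 := hlt 1 0 (by omega) (by omega)
    have := xy 1 0 (by omega) (by omega) (by omega)
    simp only [zero_mul, add_zero, zero_add] at *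
    rw [this]
    exact (h _ _ (by omega) (by omega) (by omega) l0 (by omega) l1
      (Or.inr (Or.inr ⟨rfl, haM1⟩))).symm
  | succ r ih =>
    intro h1
    rw [← ih (by omega), ← row (r + 1) (by omega) (by omega) (r + 1) (by omega),
      ← row (r + 1 + 1) (by omega) (by omega) (r + 1) (by omega),
      xy (r + 1 + 1) (r + 1) (by omega) (by omega) (by omega)]
    have l1 := hlt (r + 1) (r + 1) (by omega) (by omega)
    have l2 := hlt (r + 1 + 1) (r + 1) (by omega) (by omega)
    refine (h _ _ (by omega) (by omega) (by omega) l1 (by omega) l2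
      (Or.inr (Or.inr ⟨by ring, ?_⟩))).symm
    have e : a + (r + 1) + (r + 1) * M = a + (M + 1) * (r + 1) := by ring
    rw [e]
    exact dvd_add haM1 (Dvd.intro _ rfl)

/-- The index of a vertex. -/
def vidx {n : ℕ} (v : Fin n ⊕ Fin n) : ℕ :=
  Sum.elim (fun i : Fin n => (i : ℕ)) (fun i : Fin n => (i : ℕ)) v

theorem strip_lower (k m : ℕ)
    (B : Fin m → Finset (Fin ((2 * k + 1) * ((k + 1) * (k + 1 + 1))) ⊕
      Fin ((2 * k + 1) * ((k + 1) * (k + 1 + 1)))))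
    (hB : IsPathDecomp (strip (k + 1) ((2 * k + 1) * ((k + 1) * (k + 1 + 1)))) m B)
    (hc : ∀ i, (B i).card ≤ k + 1) : False := by
  classical
  generalize hM : k + 1 = M at *
  generalize hT : M * (M + 1) = T at *
  generalize hN : 2 * k + 1 = N at *
  generalize hn : N * T = n at *
  have hM0 : 0 < M := by omega
  have hMT : M < T := by rw [← hT]; nlinarith
  have hMdT : M ∣ T := ⟨M + 1, hT.symm⟩
  have hblock : ∀ t < N, t * T + T ≤ n := by
    intro t ht
    have := Nat.mul_le_mul_right T (show t + 1 ≤ N from ht)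
    rw [Nat.add_mul] at this; omega
  -- the leg bags
  have hleg : ∀ t, ∃ I : ℕ, t < N → ∃ (hI : I < m) (h1 : t * T < n) (h2 : t * T + M < n),
      (Sum.inl ⟨t * T, h1⟩ : Fin n ⊕ Fin n) ∈ B ⟨I, hI⟩ ∧
      (Sum.inr ⟨t * T + M, h2⟩ : Fin n ⊕ Fin n) ∈ B ⟨I, hI⟩ := by
    intro t
    by_cases ht : t < N
    · have := hblock t ht
      have h1 : t * T < n := by omega
      have h2 : t * T + M < n := by omega
      have hd : (M + 1) ∣ t * T := Dvd.dvd.mul_left ⟨M, by rw [← hT]; ring⟩ t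
      obtain ⟨I, ha, hb⟩ := hB.2.1 _ _ (strip_adj (M := M) (i := ⟨t * T, h1⟩)
        (j := ⟨t * T + M, h2⟩) (Or.inr (Or.inl ⟨rfl, Or.inr hd⟩)))
      exact ⟨I, fun _ => ⟨I.2, h1, h2, ha, hb⟩⟩
    · exact ⟨0, fun h => absurd h ht⟩
  choose f hf using hleg
  refine order_contra k N (by omega) f ?_
  intro t ht
  obtain ⟨hI, h1, h2, ha, hb⟩ := hf t ht
  set I : Fin m := ⟨f t, hI⟩ with hIdef
  set a : Fin n ⊕ Fin n := Sum.inl ⟨t * T, h1⟩ with hadef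
  set b : Fin n ⊕ Fin n := Sum.inr ⟨t * T + M, h2⟩ with hbdef
  have hab : a ≠ b := by simp [hadef, hbdef]
  have hda : vidx a % M = 0 := Nat.mod_eq_zero_of_dvd (Dvd.dvd.mul_left hMdT t)
  have hdb : vidx b % M = 0 :=
    Nat.mod_eq_zero_of_dvd (dvd_add (Dvd.dvd.mul_left hMdT t) dvd_rfl)
  -- a missed row
  obtain ⟨r, hr0, hrM, hrow⟩ : ∃ r, 0 < r ∧ r < M ∧ ∀ v ∈ B I, vidx v % M ≠ r := by
    by_contra hcon
    push Not at hcon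
    have hsub : Finset.Ioo 0 M ⊆ (((B I).erase a).erase b).image (fun v => vidx v % M) := by
      intro r hr
      rw [Finset.mem_Ioo] at hr
      obtain ⟨v, hv, hvr⟩ := hcon r hr.1 hr.2
      refine Finset.mem_image.2 ⟨v, ?_, hvr⟩
      refine Finset.mem_erase.2 ⟨?_, Finset.mem_erase.2 ⟨?_, hv⟩⟩
      · rintro rfl; omega
      · rintro rfl; omega
    have h3 := (Finset.card_le_card hsub).trans Finset.card_image_le
    have hb' : b ∈ (B I).erase a := Finset.mem_erase.2 ⟨hab.symm, hb⟩
    rw [Finset.card_erase_of_mem hb', Finset.card_erase_of_mem ha, Nat.card_Ioo] at h3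
    have h4 := hc I
    have h5 : 2 ≤ (B I).card := by
      have : ({a, b} : Finset _) ⊆ B I := by
        intro v hv
        simp only [Finset.mem_insert, Finset.mem_singleton] at hv
        rcases hv with rfl | rfl
        · exact ha
        · exact hb
      simpa [Finset.card_pair hab] using Finset.card_le_card this
    omega
  let S : Finset ℕ := (B I).image (fun v => vidx v / T)
  have hTpos : 0 < T := by omega
  have hS : S.card ≤ k := by
    have h3 : S ⊆ ((B I).erase a).image (fun v => vidx v / T) := by
      intro s hs
      obtain ⟨v, hv, rfl⟩ := Finset.mem_image.1 hs
      by_cases hva : v = a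
      · refine Finset.mem_image.2 ⟨b, Finset.mem_erase.2 ⟨hab.symm, hb⟩, ?_⟩
        subst hva
        change (t * T + M) / T = (t * T) / T
        rw [Nat.mul_div_cancel _ hTpos, Nat.add_comm, Nat.add_mul_div_right _ _ hTpos,
          Nat.div_eq_of_lt hMT, Nat.zero_add]
      · exact Finset.mem_image.2 ⟨v, Finset.mem_erase.2 ⟨hva, hv⟩, rfl⟩
    have h4 := (Finset.card_le_card h3).trans Finset.card_image_le
    rw [Finset.card_erase_of_mem ha] at h4
    have := hc I
    omega
  let PX : ℕ → Prop := fun i => ∃ h : i < n, ∃ l, l < I ∧ (Sum.inl ⟨i, h⟩ : Fin n ⊕ Fin n) ∈ B l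
  let PY : ℕ → Prop := fun i => ∃ h : i < n, ∃ l, l < I ∧ (Sum.inr ⟨i, h⟩ : Fin n ⊕ Fin n) ∈ B l
  have hadj : ∀ i j (hi : i < n) (hj : j < n), StripE M i j →
      (Sum.inl ⟨i, hi⟩ : Fin n ⊕ Fin n) ∉ B I → (Sum.inr ⟨j, hj⟩ : Fin n ⊕ Fin n) ∉ B I →
      (PX i ↔ PY j) := by
    intro i j hi hj hE hx hy
    have hA := strip_adj (M := M) (i := ⟨i, hi⟩) (j := ⟨j, hj⟩) hE
    constructor
    · rintro ⟨_, h⟩; exact ⟨hj, side_imp hB I hA hx hy h⟩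
    · rintro ⟨_, h⟩; exact ⟨hi, side_imp hB I hA.symm hy hx h⟩
  have hrowc := row_const M n r hr0 hrM PX PY (by
    intro i j hi hj hir hjr hE
    exact hadj i j hi hj hE (fun h => hrow _ h hir) (fun h => hrow _ h hjr))
  have hcol : ∀ s < N, s ∉ S → (PX (s * T) ↔ PX r) := by
    intro s hs hsS
    have hbl := hblock s hs
    have hdiv : ∀ i, s * T ≤ i → i < s * T + T → i / T = s := by
      intro i h3 h4
      rw [Nat.div_eq_iff hTpos]
      constructor
      · exact h3
      · omega
    have h3 := col_const M (s * T) n (by omega) (by rw [hT]; exact Dvd.intro_left _ rfl) PX PY (by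
      intro i j hi hj h3 h4 h5 h6 hE
      rw [hT] at h4 h6
      exact hadj i j hi hj hE
        (fun h => hsS (Finset.mem_image.2 ⟨_, h, hdiv i h3 h4⟩))
        (fun h => hsS (Finset.mem_image.2 ⟨_, h, hdiv j h5 h6⟩))) (r - 1) (by omega)
    rw [← h3]
    have e : s * T + (r - 1 + 1) = r + (s * (M + 1)) * M := by
      rw [← hT, Nat.sub_add_cancel hr0]; ring
    rw [e]
    apply hrowc
    rw [← e]; omega
  have hout : ∀ s (hs : s * T < n), s ∉ S → (Sum.inl ⟨s * T, hs⟩ : Fin n ⊕ Fin n) ∉ B I := by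
    intro s hs hsS h
    exact hsS (Finset.mem_image.2 ⟨_, h, Nat.mul_div_cancel _ hTpos⟩)
  refine ⟨S, hS, ?_⟩
  by_cases hP : PX r
  · left
    intro s hs hsS
    obtain ⟨hI', h1', _, ha', _⟩ := hf s hs
    obtain ⟨_, l, hl, hm⟩ := (hcol s hs hsS).2 hP
    by_contra hcon
    exact hout s h1' hsS (hB.2.2 _ l I ⟨f s, hI'⟩ hl.le (Fin.mk_le_mk.2 (not_lt.1 hcon)) hm ha')
  · right
    intro s hs hsS
    obtain ⟨hI', h1', _, ha', _⟩ := hf s hs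
    have hnP : ¬ PX (s * T) := fun h => hP ((hcol s hs hsS).1 h)
    by_contra hcon
    rcases lt_or_eq_of_le (not_lt.1 hcon) with h | h
    · exact hnP ⟨h1', ⟨f s, hI'⟩, Fin.mk_lt_mk.2 h, ha'⟩
    · apply hout s h1' hsS
      have : I = ⟨f s, hI'⟩ := Fin.ext h.symm
      rw [this]; exact ha'

theorem stmt0 (k : ℕ) :
    ∃ (V : Type) (G : SimpleGraph V), IsTwoLayerKPlanar G k ∧ pathwidth G = k + 1 := by
  have hp := strip_planar k ((2 * k + 1) * ((k + 1) * (k + 1 + 1)))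
  obtain ⟨H, h1, h2⟩ := exists_exact _ k hp (by
    by_contra hcon
    obtain ⟨m, B, hB, hc⟩ := pw_spec (strip (k + 1) ((2 * k + 1) * ((k + 1) * (k + 1 + 1))))
    exact strip_lower k m B hB (fun i => (hc i).trans (by omega)))
  exact ⟨_, H, h1, h2⟩
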